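/- Let ℓ₁, ℓ₂, ℓ₃ ≥ 1 and let Θ = Θ(ℓ₁,ℓ₂,ℓ₃) be the theta space with segment lengths ℓ₁, ℓ₂, ℓ₃ and metric d. Then Θ does not have negative type: there exists a finitely supported function ω : Θ → ℝ with ∑_x ω(x) = 0 and ∑_{x,y} ω(x)ω(y) d(x,y) > 0. -/

import Mathlib

/-- Given two distinct indices in `Fin 3`, the remaining index. -/
def thetaOther (i j : Fin 3) : Fin 3 := if j = i + 1 then i + 2 else i + 1

/-- The shortest-path distance on the theta space `Θ(ℓ 0, ℓ 1, ℓ 2)`, expressed on raw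
coordinates: a point `(i, s)` is the point at distance `s` from `u` along the `i`-th
segment (of length `ℓ i`), where all points `(i, 0)` are identified to a single
point `u` and all points `(i, ℓ i)` are identified to a single point `v`. -/
noncomputable def thetaDist (ℓ : Fin 3 → ℝ) (p q : Fin 3 × ℝ) : ℝ :=
  if p.1 = q.1 then
    min |p.2 - q.2|
      (min (p.2 + q.2 + min (ℓ (p.1 + 1)) (ℓ (p.1 + 2)))
        ((ℓ p.1 - p.2) + (ℓ p.1 - q.2) + min (ℓ (p.1 + 1)) (ℓ (p.1 + 2))))
  else
    min (p.2 + q.2)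
      (min ((ℓ p.1 - p.2) + (ℓ q.1 - q.2))
        (min (p.2 + ℓ (thetaOther p.1 q.1) + (ℓ q.1 - q.2))
          ((ℓ p.1 - p.2) + ℓ (thetaOther p.1 q.1) + q.2)))

/-- `(i, s)` is a valid coordinate for a point of the theta space `Θ(ℓ 0, ℓ 1, ℓ 2)`. -/
def IsThetaPoint (ℓ : Fin 3 → ℝ) (p : Fin 3 × ℝ) : Prop :=
  0 ≤ p.2 ∧ p.2 ≤ ℓ p.1

/-- Canonical representatives of the points of the theta space `Θ(ℓ 0, ℓ 1, ℓ 2)`: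
every point of the theta space has exactly one canonical coordinate representative,
the two branch vertices `u, v` being represented on segment `0`. -/
def IsThetaRep (ℓ : Fin 3 → ℝ) (p : Fin 3 × ℝ) : Prop :=
  IsThetaPoint ℓ p ∧ (p.2 = 0 → p.1 = 0) ∧ (p.2 = ℓ p.1 → p.1 = 0)

theorem thetaDist_comm (ℓ : Fin 3 → ℝ) (p q : Fin 3 × ℝ) :
    thetaDist ℓ p q = thetaDist ℓ q p := by
  obtain ⟨i, s⟩ := p
  obtain ⟨j, t⟩ := q
  fin_cases i <;> fin_cases j <;> simp [thetaDist, thetaOther, abs_sub_comm] <;> grind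

theorem thetaDist_same {ℓ : Fin 3 → ℝ} (hℓ : ∀ i, 0 ≤ ℓ i) {i : Fin 3} {s t : ℝ}
    (hs : IsThetaPoint ℓ (i, s)) (ht : IsThetaPoint ℓ (i, t)) :
    thetaDist ℓ (i, s) (i, t) = |s - t| := by
  obtain ⟨hs₀, hs₁⟩ := hs
  obtain ⟨ht₀, ht₁⟩ := ht
  have hm := le_min (hℓ (i + 1)) (hℓ (i + 2))
  simp only [thetaDist, if_true] at *
  exact min_eq_left (le_min (abs_le.2 ⟨by linarith, by linarith⟩)
    (abs_le.2 ⟨by linarith, by linarith⟩))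

theorem thetaDist_of_ne {ℓ : Fin 3 → ℝ} {i j k : Fin 3} (hij : i ≠ j) (hik : i ≠ k)
    (hjk : j ≠ k) (s t : ℝ) :
    thetaDist ℓ (i, s) (j, t) = min (s + t) (min ((ℓ i - s) + (ℓ j - t))
      (min (s + ℓ k + (ℓ j - t)) ((ℓ i - s) + ℓ k + t))) := by
  have h : thetaOther i j = k := by
    revert i j k
    decide
  simp [thetaDist, hij, h]

theorem isThetaRep_of_interior {ℓ : Fin 3 → ℝ} {i : Fin 3} {s : ℝ} (h₀ : 0 < s)
    (h₁ : s < ℓ i) : IsThetaRep ℓ (i, s) :=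
  ⟨⟨h₀.le, h₁.le⟩, fun h => absurd h h₀.ne', fun h => absurd h h₁.ne⟩

/-- A weighted family of (not necessarily distinct) canonical points with total weight `0` and
positive energy witnesses the failure of negative type. -/
theorem exists_finsupp_of_weighted_points {ι : Type*} [Fintype ι] {ℓ : Fin 3 → ℝ}
    (P : ι → Fin 3 × ℝ) (c : ι → ℝ) (hP : ∀ n, IsThetaRep ℓ (P n))
    (hc : ∑ n, c n = 0) (hE : 0 < ∑ m, ∑ n, c m * c n * thetaDist ℓ (P m) (P n)) :
    ∃ ω : (Fin 3 × ℝ) →₀ ℝ,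
      (∀ p ∈ ω.support, IsThetaRep ℓ p) ∧
      (∑ x ∈ ω.support, ω x) = 0 ∧
      0 < ∑ x ∈ ω.support, ∑ y ∈ ω.support, ω x * ω y * thetaDist ℓ x y := by
  classical
  set ω : (Fin 3 × ℝ) →₀ ℝ := ∑ n, Finsupp.single (P n) (c n) with hω
  have sum_eq (g : Fin 3 × ℝ → ℝ) : ∑ x ∈ ω.support, ω x * g x = ∑ n, c n * g (P n) := by
    change ω.sum (fun x a => a * g x) = _
    rw [hω, ← Finsupp.sum_finsetSum_index (by simp) (by intros; ring)]
    simp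
  refine ⟨ω, fun p hp => ?_, ?_, ?_⟩
  · obtain ⟨n, -, hn⟩ := Finset.mem_biUnion.1 (Finsupp.support_finsetSum hp)
    rw [Finset.mem_singleton.1 (Finsupp.support_single_subset hn)]
    exact hP n
  · simpa [hc] using sum_eq fun _ => 1
  · simp_rw [mul_assoc, ← Finset.mul_sum]
    rw [sum_eq]
    simp_rw [sum_eq, Finset.mul_sum, ← mul_assoc]
    exact hE

theorem exists_sorted_indices (ℓ : Fin 3 → ℝ) :
    ∃ i j k : Fin 3, i ≠ j ∧ i ≠ k ∧ j ≠ k ∧ ℓ i ≤ ℓ j ∧ ℓ j ≤ ℓ k := by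
  rcases le_total (ℓ 0) (ℓ 1) with h | h <;> rcases le_total (ℓ 1) (ℓ 2) with h' | h' <;>
    rcases le_total (ℓ 0) (ℓ 2) with h'' | h''
  · exact ⟨0, 1, 2, by decide, by decide, by decide, h, h'⟩
  · exact ⟨0, 1, 2, by decide, by decide, by decide, h, h'⟩
  · exact ⟨0, 2, 1, by decide, by decide, by decide, h'', h'⟩
  · exact ⟨2, 0, 1, by decide, by decide, by decide, h'', h⟩
  · exact ⟨1, 0, 2, by decide, by decide, by decide, h, h''⟩
  · exact ⟨1, 2, 0, by decide, by decide, by decide, h', h''⟩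
  · exact ⟨2, 1, 0, by decide, by decide, by decide, h', h⟩
  · exact ⟨2, 1, 0, by decide, by decide, by decide, h', h⟩

/-- a theta space all of whose three segment lengths are at least `1`
does not have negative type: there is a finitely supported function `ω` on its points
(given by their canonical representatives) with total sum `0` and positive energy
`∑ ω(x) ω(y) d(x,y)`. -/
theorem theta_not_negative_type (ℓ : Fin 3 → ℝ) (hℓ : ∀ i, 1 ≤ ℓ i) :
    ∃ ω : (Fin 3 × ℝ) →₀ ℝ,
      (∀ p ∈ ω.support, IsThetaRep ℓ p) ∧
      (∑ x ∈ ω.support, ω x) = 0 ∧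
      0 < ∑ x ∈ ω.support, ∑ y ∈ ω.support, ω x * ω y * thetaDist ℓ x y := by
  have hpos : ∀ i, 0 < ℓ i := fun i => one_pos.trans_le (hℓ i)
  obtain ⟨i, j, k, hij, hik, hjk, hab, hbc⟩ := exists_sorted_indices ℓ
  have ha := hpos i
  have rU : IsThetaRep ℓ (i, ℓ i / 4) := isThetaRep_of_interior (by linarith) (by linarith)
  have rV : IsThetaRep ℓ (j, ℓ j / 2 + ℓ i / 4) :=
    isThetaRep_of_interior (by linarith) (by linarith)
  have rY : IsThetaRep ℓ (i, ℓ i / 2) := isThetaRep_of_interior (by linarith) (by linarith)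
  have rW : IsThetaRep ℓ (j, ℓ j / 2) := isThetaRep_of_interior (by linarith) (by linarith)
  have rZ : IsThetaRep ℓ (k, ℓ k / 2) := isThetaRep_of_interior (by linarith) (by linarith)
  -- Two antipodal pairs on the cycle formed by the two shortest segments have energy zero;
  -- moving a little mass from the midpoint of the longest segment to the cycle makes it positive.
  refine exists_finsupp_of_weighted_points
    ![(i, ℓ i / 4), (j, ℓ j / 2 + ℓ i / 4), (i, ℓ i / 2), (j, ℓ j / 2), (k, ℓ k / 2)]
    ![2 * ℓ k + ℓ i, 2 * ℓ k, -(2 * ℓ k), -(2 * ℓ k), -ℓ i] ?_ ?_ ?_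
  · intro n
    fin_cases n
    exacts [rU, rV, rY, rW, rZ]
  · simp only [Fin.sum_univ_five, Matrix.cons_val]
    ring
  have same {l : Fin 3} {s t : ℝ} (hs : IsThetaRep ℓ (l, s)) (ht : IsThetaRep ℓ (l, t)) :=
    thetaDist_same (fun i => (hpos i).le) hs.1 ht.1
  have dUV : thetaDist ℓ (i, ℓ i / 4) (j, ℓ j / 2 + ℓ i / 4) = (ℓ i + ℓ j) / 2 := by
    rw [thetaDist_of_ne hij hik hjk]; grind
  have dUY : thetaDist ℓ (i, ℓ i / 4) (i, ℓ i / 2) = ℓ i / 4 := by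
    rw [same rU rY]; grind
  have dUW : thetaDist ℓ (i, ℓ i / 4) (j, ℓ j / 2) = ℓ i / 4 + ℓ j / 2 := by
    rw [thetaDist_of_ne hij hik hjk]; grind
  have dUZ : thetaDist ℓ (i, ℓ i / 4) (k, ℓ k / 2) = ℓ i / 4 + ℓ k / 2 := by
    rw [thetaDist_of_ne hik hij hjk.symm]; grind
  have dVY : thetaDist ℓ (j, ℓ j / 2 + ℓ i / 4) (i, ℓ i / 2) = ℓ j / 2 + ℓ i / 4 := by
    rw [thetaDist_of_ne hij.symm hjk hik]; grind
  have dVW : thetaDist ℓ (j, ℓ j / 2 + ℓ i / 4) (j, ℓ j / 2) = ℓ i / 4 := by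
    rw [same rV rW]; grind
  have dVZ : thetaDist ℓ (j, ℓ j / 2 + ℓ i / 4) (k, ℓ k / 2) =
      ℓ j / 2 - ℓ i / 4 + ℓ k / 2 := by
    rw [thetaDist_of_ne hjk hij.symm hik.symm]; grind
  have dYW : thetaDist ℓ (i, ℓ i / 2) (j, ℓ j / 2) = (ℓ i + ℓ j) / 2 := by
    rw [thetaDist_of_ne hij hik hjk]; grind
  have dYZ : thetaDist ℓ (i, ℓ i / 2) (k, ℓ k / 2) = (ℓ i + ℓ k) / 2 := by
    rw [thetaDist_of_ne hik hij hjk.symm]; grind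
  have dWZ : thetaDist ℓ (j, ℓ j / 2) (k, ℓ k / 2) = (ℓ j + ℓ k) / 2 := by
    rw [thetaDist_of_ne hjk hij.symm hik.symm]; grind
  have hE : 0 < ℓ i ^ 2 * (2 * ℓ k - ℓ i) / 2 := by
    have : 0 < 2 * ℓ k - ℓ i := by linarith
    positivity
  convert hE using 1
  simp only [Fin.sum_univ_five, Matrix.cons_val]
  rw [thetaDist_comm ℓ (j, ℓ j / 2 + ℓ i / 4) (i, ℓ i / 4),
    thetaDist_comm ℓ (i, ℓ i / 2) (i, ℓ i / 4),
    thetaDist_comm ℓ (j, ℓ j / 2) (i, ℓ i / 4), thetaDist_comm ℓ (k, ℓ k / 2) (i, ℓ i / 4),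
    thetaDist_comm ℓ (i, ℓ i / 2) (j, ℓ j / 2 + ℓ i / 4),
    thetaDist_comm ℓ (j, ℓ j / 2) (j, ℓ j / 2 + ℓ i / 4),
    thetaDist_comm ℓ (k, ℓ k / 2) (j, ℓ j / 2 + ℓ i / 4),
    thetaDist_comm ℓ (j, ℓ j / 2) (i, ℓ i / 2), thetaDist_comm ℓ (k, ℓ k / 2) (i, ℓ i / 2),
    thetaDist_comm ℓ (k, ℓ k / 2) (j, ℓ j / 2),
    dUV, dUY, dUW, dUZ, dVY, dVW, dVZ, dYW, dYZ, dWZ,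
    same rU rU, same rV rV, same rY rY, same rW rW, same rZ rZ]
  simp only [sub_self, abs_zero]
  ring
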